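/- For every real t > 0 and every integer n ≥ 5, the sequence (g_{n,d}(t))_{d=1}^{n-1} satisfies the higher order Turán inequality: for 2 ≤ d ≤ n-3, 4·(g_{n,d}(t)² − g_{n,d-1}(t)·g_{n,d+1}(t))·(g_{n,d+1}(t)² − g_{n,d}(t)·g_{n,d+2}(t)) ≥ (g_{n,d}(t)·g_{n,d+1}(t) − g_{n,d-1}(t)·g_{n,d+2}(t))². -/

import Mathlib

open Polynomial Finset

/-- Speyer's g-polynomial of the uniform matroid `U_{n,d}`, evaluated at `t`. -/
noncomputable def speyerG (n d : ℕ) (t : ℝ) : ℝ :=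
  ∑ i ∈ Finset.Icc 1 d,
    ((n - i - 1).choose (d - i) : ℝ) * ((n - d - 1).choose (i - 1) : ℝ) * t ^ i

/-- The generating polynomial `h_n(x;t) = ∑_{d=1}^{n-1} g_{n,d}(t) x^d` (in `x`). -/
noncomputable def hPoly (n : ℕ) (t : ℝ) : Polynomial ℝ :=
  ∑ d ∈ Finset.Icc 1 (n - 1), Polynomial.C (speyerG n d t) * Polynomial.X ^ d

/-- Recursive form of the generating polynomial. -/
noncomputable def genF (t : ℝ) : ℕ → Polynomial ℝ
  | 0 => 1
  | 1 => X + 1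
  | (m + 2) => (X + 1) * genF t (m + 1) + C t * (X * genF t m)

/-- The trinomial coefficients. -/
def triC (m e j : ℕ) : ℕ := if j ≤ e then (m - j).choose (e - j) * (m - e).choose j else 0

lemma triC_succ (m e j : ℕ) :
    triC (m + 2) (e + 1) (j + 1) =
      triC (m + 1) (e + 1) (j + 1) + triC (m + 1) e (j + 1) + triC m e j := by
  unfold triC
  by_cases hj : j ≤ e
  · obtain ⟨a, rfl⟩ := Nat.exists_eq_add_of_le hj
    by_cases hm : j + a + j ≤ m
    · obtain ⟨c, rfl⟩ := Nat.exists_eq_add_of_le hm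
      have e1 : j + a + j + c + 2 - (j + 1) = a + j + c + 1 := by omega
      have e2 : j + a + 1 - (j + 1) = a := by omega
      have e3 : j + a + j + c + 2 - (j + a + 1) = j + c + 1 := by omega
      have e4 : j + a + j + c + 1 - (j + 1) = a + j + c := by omega
      have e5 : j + a + j + c + 1 - (j + a + 1) = j + c := by omega
      have e6 : j + a + j + c + 1 - (j + a) = j + c + 1 := by omega
      have e7 : j + a + j + c - j = a + j + c := by omega
      have e8 : j + a - j = a := by omega
      have e9 : j + a + j + c - (j + a) = j + c := by omega
      rw [e1, e2, e3, e4, e5, e6, e7, e8, e9]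
      rcases a with _ | a
      · have h1 : ¬ (j + 1 ≤ j + 0) := by omega
        simp [Nat.choose_succ_succ]
        ring
      · have h1 : j + 1 ≤ j + (a + 1) := by omega
        have h2 : j + 1 ≤ j + (a + 1) + 1 := by omega
        have h3 : j ≤ j + (a + 1) := by omega
        have h4 : j + (a + 1) - (j + 1) = a := by omega
        simp only [h1, h2, h3, if_true, h4]
        rw [Nat.choose_succ_succ (a + 1 + j + c) a, Nat.choose_succ_succ (j + c) j]
        ring
    · have z1 : (m + 2 - (j + a + 1)).choose (j + 1) = 0 := Nat.choose_eq_zero_of_lt (by omega)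
      have z2 : (m + 1 - (j + a + 1)).choose (j + 1) = 0 := Nat.choose_eq_zero_of_lt (by omega)
      have z3 : (m + 1 - (j + a)).choose (j + 1) = 0 := Nat.choose_eq_zero_of_lt (by omega)
      have z4 : (m - j).choose (j + a - j) * (m - (j + a)).choose j = 0 := by
        rcases Nat.eq_zero_or_pos j with h | h
        · rw [Nat.choose_eq_zero_of_lt (by omega), zero_mul]
        · rw [Nat.choose_eq_zero_of_lt (n := m - (j + a)) (by omega), mul_zero]
      rw [z1, z2, z3, z4]
      simp
  · have h1 : ¬ (j + 1 ≤ e + 1) := by omega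
    have h2 : ¬ (j + 1 ≤ e) := by omega
    simp [hj, h2]

lemma triC_zero (m e : ℕ) : triC (m + 1) (e + 1) 0 = triC m (e + 1) 0 + triC m e 0 := by
  simp [triC, Nat.choose_succ_succ, add_comm]

lemma triC_gt (m e j : ℕ) (h : e < j) : triC m e j = 0 := by
  unfold triC
  rw [if_neg (by omega)]

/-- The coefficients as sums. -/
noncomputable def genG (t : ℝ) (m e : ℕ) : ℝ := ∑ j ∈ Finset.range (e + 1), (triC m e j : ℝ) * t ^ j

lemma genG_eq (t : ℝ) (m e : ℕ) :
    genG t m e = ∑ j ∈ Finset.range (e + 2), (triC m e j : ℝ) * t ^ j := by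
  rw [Finset.sum_range_succ _ (e + 1), triC_gt m e (e + 1) (by omega)]
  simp [genG]

lemma genG_rec (t : ℝ) (m e : ℕ) :
    genG t (m + 2) (e + 1) = genG t (m + 1) (e + 1) + genG t (m + 1) e + t * genG t m e := by
  rw [genG_eq t (m + 1) e]
  unfold genG
  rw [Finset.sum_range_succ' _ (e + 1), Finset.sum_range_succ' _ (e + 1),
    Finset.sum_range_succ' _ (e + 1), Finset.mul_sum]
  simp only [triC_succ, triC_zero (m + 1) e]
  push_cast
  simp only [add_mul, Finset.sum_add_distrib]
  have : ∀ j, (triC m e j : ℝ) * t ^ (j + 1) = t * ((triC m e j : ℝ) * t ^ j) := by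
    intro j; ring
  simp only [this]
  ring

lemma genG_zero (t : ℝ) (m : ℕ) : genG t m 0 = 1 := by simp [genG, triC]

lemma genF_coeff (t : ℝ) : ∀ m e : ℕ, (genF t m).coeff e = genG t m e
  | 0, 0 => by simp [genF, genG_zero]
  | 0, e + 1 => by
    rw [genF, coeff_one, if_neg (by omega)]
    symm
    apply Finset.sum_eq_zero
    intro j _
    rcases j with _ | j
    · simp [triC]
    · simp [triC]
  | 1, 0 => by simp [genF, genG_zero]
  | 1, e + 1 => by
    rw [genF, coeff_add, coeff_one, if_neg (by omega), coeff_X]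
    unfold genG
    rw [Finset.sum_range_succ', Finset.sum_eq_zero]
    · rcases e with _ | e
      · simp [triC]
      · simp [triC, Nat.choose_eq_zero_of_lt]
    · intro j _
      simp [triC]
  | m + 2, 0 => by
    have := genF_coeff t (m + 1) 0
    rw [genG_zero] at this ⊢
    simp [genF, add_mul, this]
  | m + 2, e + 1 => by
    rw [genG_rec, ← genF_coeff t (m + 1) (e + 1), ← genF_coeff t (m + 1) e, ← genF_coeff t m e]
    simp only [genF, add_mul, coeff_add, coeff_X_mul, one_mul, coeff_C_mul]
    ring

lemma speyerG_eq (t : ℝ) (m e : ℕ) : speyerG (m + 2) (e + 1) t = t * (genF t m).coeff e := by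
  rw [genF_coeff, speyerG, genG, Finset.mul_sum]
  symm
  refine Finset.sum_bij (fun j _ => j + 1) ?_ ?_ ?_ ?_
  · intro j hj
    simp only [Finset.mem_range] at hj
    simp only [Finset.mem_Icc]
    omega
  · intro a _ b _ hab
    omega
  · intro b hb
    simp only [Finset.mem_Icc] at hb
    exact ⟨b - 1, by simp only [Finset.mem_range]; omega, by omega⟩
  · intro j hj
    simp only [Finset.mem_range] at hj
    have a1 : m + 2 - (j + 1) - 1 = m - j := by omega
    have a2 : e + 1 - (j + 1) = e - j := by omega
    have a3 : m + 2 - (e + 1) - 1 = m - e := by omega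
    have a4 : j + 1 - 1 = j := by omega
    rw [a1, a2, a3, a4, triC, if_pos (by omega)]
    push_cast
    ring

lemma genF_coeff_pos (t : ℝ) (ht : 0 < t) (m e : ℕ) (h : e ≤ m) : 0 < (genF t m).coeff e := by
  rw [genF_coeff, genG, Finset.sum_range_succ']
  apply add_pos_of_nonneg_of_pos
  · positivity
  · have := Nat.choose_pos h
    simp [triC]
    exact this

lemma genF_natDegree (t : ℝ) : ∀ m, (genF t m).natDegree ≤ m
  | 0 => by simp [genF]
  | 1 => by rw [genF]; compute_degree
  | m + 2 => by
    have h1 := genF_natDegree t (m + 1)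
    have h2 := genF_natDegree t m
    rw [genF]
    refine natDegree_add_le_of_degree_le ?_ ?_
    · refine natDegree_mul_le.trans ?_
      have : (X + 1 : ℝ[X]).natDegree ≤ 1 := by compute_degree
      omega
    · refine (natDegree_C_mul_le _ _).trans (natDegree_mul_le.trans ?_)
      have : (X : ℝ[X]).natDegree ≤ 1 := natDegree_X_le
      omega

lemma genF_trig (s y θ : ℝ) (h : 1 - y ^ 2 = - 2 * y * s * Real.cos θ) :
    ∀ m : ℕ, (genF (s ^ 2) m).eval (- y ^ 2) * Real.sin θ
      = (-(y * s)) ^ m * Real.sin ((m + 1) * θ)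
  | 0 => by simp [genF]
  | 1 => by
    have : ((1 : ℕ) + 1 : ℝ) * θ = 2 * θ := by norm_num
    rw [this, Real.sin_two_mul]
    simp only [genF, eval_add, eval_X, eval_one]
    linear_combination Real.sin θ * h
  | m + 2 => by
    have h1 := genF_trig s y θ h (m + 1)
    have h2 := genF_trig s y θ h m
    have e1 : (((m + 2 : ℕ) : ℝ) + 1) * θ = (((m + 1 : ℕ) : ℝ) + 1) * θ + θ := by push_cast; ring
    have e2 : ((m : ℝ) + 1) * θ = (((m + 1 : ℕ) : ℝ) + 1) * θ - θ := by push_cast; ring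
    rw [e2, Real.sin_sub] at h2
    rw [e1, Real.sin_add]
    simp only [genF, eval_add, eval_X, eval_one, eval_mul, eval_C]
    generalize Real.sin ((((m + 1 : ℕ) : ℝ) + 1) * θ) = S at *
    generalize Real.cos ((((m + 1 : ℕ) : ℝ) + 1) * θ) = D at *
    have w1 : (-(y * s)) ^ (m + 1) = (-(y * s)) ^ m * (-(y * s)) := pow_succ _ _
    have w2 : (-(y * s)) ^ (m + 2) = (-(y * s)) ^ m * (-(y * s)) ^ 2 := pow_add _ _ _
    rw [w1] at h1
    rw [w2]
    linear_combination (1 - y ^ 2) * h1 - s ^ 2 * y ^ 2 * h2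
      + (-(y * s)) ^ m * (-(y * s)) * S * h

lemma genF_splits (t : ℝ) (ht : 0 < t) (m : ℕ) : (genF t m).Splits := by
  rw [splits_iff_card_roots]
  apply le_antisymm (card_roots' _)
  refine (genF_natDegree t m).trans ?_
  have hne : genF t m ≠ 0 := by
    intro h
    have := genF_coeff_pos t ht m 0 (Nat.zero_le _)
    simp [h] at this
  set s := Real.sqrt t with hs
  have hs0 : 0 < s := Real.sqrt_pos.2 ht
  have hst : s ^ 2 = t := Real.sq_sqrt ht.le
  let θ : ℕ → ℝ := fun k => (k + 1) * Real.pi / (m + 1)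
  let c : ℕ → ℝ := fun k => s * Real.cos (θ k)
  let y : ℕ → ℝ := fun k => c k + Real.sqrt (c k ^ 2 + 1)
  have hm : (0 : ℝ) < m + 1 := by positivity
  have hy0 : ∀ k, 0 < y k := by
    intro k
    have : |c k| < Real.sqrt (c k ^ 2 + 1) := by
      rw [← Real.sqrt_sq_eq_abs]
      exact Real.sqrt_lt_sqrt (sq_nonneg _) (by linarith)
    have := neg_abs_le (c k)
    simp only [y]
    linarith
  have hyc : ∀ k, y k ^ 2 - 2 * c k * y k - 1 = 0 := by
    intro k
    have : Real.sqrt (c k ^ 2 + 1) ^ 2 = c k ^ 2 + 1 := Real.sq_sqrt (by positivity)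
    simp only [y]
    linear_combination this
  have hθ : ∀ k, k < m → 0 < θ k ∧ θ k < Real.pi := by
    intro k hk
    have hk' : (k : ℝ) + 1 < m + 1 := by
      have : (k : ℝ) < m := by exact_mod_cast hk
      linarith
    refine ⟨by have := Real.pi_pos; simp only [θ]; positivity, ?_⟩
    simp only [θ]
    rw [div_lt_iff₀ hm]
    nlinarith [Real.pi_pos]
  have hinj : Set.InjOn (fun k => - y k ^ 2) (Finset.range m : Set ℕ) := by
    intro k hk l hl hkl
    have hk := hθ k (by simpa using hk)
    have hl := hθ l (by simpa using hl)
    have h1 : y k = y l := by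
      have : y k ^ 2 = y l ^ 2 := by simpa using hkl
      exact (pow_left_inj₀ (hy0 k).le (hy0 l).le (by norm_num)).1 this
    have h2 : c k = c l := by
      have a := hyc k
      have b := hyc l
      rw [h1] at a
      have : (c k - c l) * y l = 0 := by linear_combination (b - a) / 2
      rcases mul_eq_zero.1 this with h | h
      · linarith
      · exact absurd h (hy0 l).ne'
    have h3 : Real.cos (θ k) = Real.cos (θ l) := mul_left_cancel₀ hs0.ne' h2
    have h4 : θ k = θ l := Real.injOn_cos ⟨hk.1.le, hk.2.le⟩ ⟨hl.1.le, hl.2.le⟩ h3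
    simp only [θ] at h4
    field_simp at h4
    have : (k : ℝ) = l := by linarith
    exact_mod_cast this
  have hsub : (Finset.range m).image (fun k => - y k ^ 2) ⊆ (genF t m).roots.toFinset := by
    intro x hx
    obtain ⟨k, hk, rfl⟩ := Finset.mem_image.1 hx
    have hk' := hθ k (by simpa using hk)
    rw [Multiset.mem_toFinset, mem_roots hne, IsRoot.def]
    have h := genF_trig s (y k) (θ k) (by
      have := hyc k
      simp only [c] at this
      linear_combination -this) m
    have hz : Real.sin ((m + 1) * θ k) = 0 := by
      have : (m + 1) * θ k = ((k + 1 : ℕ) : ℝ) * Real.pi := by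
        simp only [θ]
        push_cast
        field_simp
      rw [this, Real.sin_nat_mul_pi]
    rw [hz, mul_zero, hst] at h
    rcases mul_eq_zero.1 h with h | h
    · exact h
    · exact absurd h (Real.sin_pos_of_pos_of_lt_pi hk'.1 hk'.2).ne'
  have hc := Finset.card_le_card hsub
  rw [Finset.card_image_of_injOn hinj, Finset.card_range] at hc
  exact hc.trans (Multiset.toFinset_card_le _)

lemma splits_derivative_real (p : ℝ[X]) (hp : p.Splits) : (derivative p).Splits := by
  by_cases h0 : p.natDegree = 0
  · rw [derivative_of_natDegree_zero h0]
    simp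
  · rw [splits_iff_card_roots] at hp ⊢
    have h1 := card_roots_le_derivative p
    have h2 := natDegree_derivative_lt h0
    have h3 := card_roots' (derivative p)
    omega

lemma splits_iterate_derivative_real (p : ℝ[X]) (hp : p.Splits) (k : ℕ) :
    (derivative^[k] p).Splits := by
  induction k with
  | zero => exact hp
  | succ k ih =>
    rw [Function.iterate_succ_apply']
    exact splits_derivative_real _ ih

/-- The first four coefficients are expressed by power sums of reciprocal roots. -/
def PowForm (p : ℝ[X]) : Prop := ∃ c p1 p2 p3 : ℝ, 0 ≤ p2 ∧ p3 ^ 2 ≤ p2 ^ 3 ∧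
  p.coeff 0 = c ∧ p.coeff 1 = c * p1 ∧ 2 * p.coeff 2 = c * (p1 ^ 2 - p2) ∧
  6 * p.coeff 3 = c * (p1 ^ 3 - 3 * p1 * p2 + 2 * p3)

lemma PowForm.mul_lin (p : ℝ[X]) (hp : PowForm p) (r : ℝ) (hr : r ≠ 0) :
    PowForm ((X - C r) * p) := by
  obtain ⟨c, p1, p2, p3, h2, h3, c0, c1, c2, c3⟩ := hp
  obtain ⟨l, hl⟩ : ∃ l, r * l = -1 := ⟨-1 / r, by field_simp⟩
  refine ⟨-r * c, p1 + l, p2 + l ^ 2, p3 + l ^ 3, by positivity, ?_, ?_, ?_, ?_, ?_⟩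
  · have key : |2 * p3 * l| ≤ p2 ^ 2 + p2 * l ^ 2 := by
      apply abs_le_of_sq_le_sq _ (by positivity)
      have : p3 ^ 2 * l ^ 2 ≤ p2 ^ 3 * l ^ 2 := by gcongr
      nlinarith [sq_nonneg (p2 ^ 2 - p2 * l ^ 2)]
    have key2 := mul_le_mul_of_nonneg_right ((le_abs_self _).trans key) (sq_nonneg l)
    have : 0 ≤ p2 ^ 2 * l ^ 2 := by positivity
    have : 0 ≤ p2 * l ^ 4 := by positivity
    nlinarith
  · simp [sub_mul, c0]
  · simp only [sub_mul, coeff_sub, coeff_X_mul, coeff_C_mul, c0, c1]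
    linear_combination c * hl
  · simp only [sub_mul, coeff_sub, coeff_X_mul, coeff_C_mul, c1]
    linear_combination - r * c2 + 2 * c * p1 * hl
  · simp only [sub_mul, coeff_sub, coeff_X_mul, coeff_C_mul]
    linear_combination 3 * c2 - r * c3 + 3 * c * (p1 ^ 2 - p2) * hl

lemma PowForm.prod (s : Multiset ℝ) (hs : (0 : ℝ) ∉ s) :
    PowForm (s.map (fun a => X - C a)).prod := by
  induction s using Multiset.induction_on with
  | empty => exact ⟨1, 0, 0, 0, by simp [coeff_one]⟩
  | cons a s ih =>
    rw [Multiset.mem_cons, not_or] at hs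
    rw [Multiset.map_cons, Multiset.prod_cons]
    exact PowForm.mul_lin _ (ih hs.2) a (Ne.symm hs.1)

lemma PowForm.of_splits (p : ℝ[X]) (hp : p.Splits) (h0 : p.coeff 0 ≠ 0) : PowForm p := by
  have hr : (0 : ℝ) ∉ p.roots := by
    intro h
    have := (mem_roots'.1 h).2
    rw [IsRoot.def, ← coeff_zero_eq_eval_zero] at this
    exact h0 this
  obtain ⟨c, p1, p2, p3, h2, h3, c0, c1, c2, c3⟩ := PowForm.prod p.roots hr
  have e := hp.eq_prod_roots
  refine ⟨p.leadingCoeff * c, p1, p2, p3, h2, h3, ?_, ?_, ?_, ?_⟩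
  all_goals
    rw [e, coeff_C_mul, ← e]
  · rw [c0]
  · rw [c1]; ring
  · linear_combination p.leadingCoeff * c2
  · linear_combination p.leadingCoeff * c3

lemma turan_weight (K a0 a1 a2 a3 f0 f1 f2 f3 : ℝ) (hK : 0 < K)
    (h0 : 0 < a0) (h1 : 0 < a1) (h2 : 0 < a2)
    (hA : 0 ≤ a1 ^ 2 - a0 * a2)
    (hT : (a1 * a2 - a0 * a3) ^ 2 ≤ 4 * (a1 ^ 2 - a0 * a2) * (a2 ^ 2 - a1 * a3))
    (e0 : a0 = f0) (e1 : a1 = K * f1) (e2 : a2 = K * (K + 1) * f2)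
    (e3 : a3 = K * (K + 1) * (K + 2) * f3) :
    (f1 * f2 - f0 * f3) ^ 2 ≤ 4 * (f1 ^ 2 - f0 * f2) * (f2 ^ 2 - f1 * f3) := by
  have hB : 0 ≤ a2 ^ 2 - a1 * a3 := by
    rcases hA.eq_or_lt with h | h
    · rw [← h] at hT
      have hC : a1 * a2 - a0 * a3 = 0 := by
        apply pow_eq_zero_iff (two_ne_zero) |>.1
        exact le_antisymm (by linarith) (sq_nonneg _)
      have : a0 * (a2 ^ 2 - a1 * a3) = 0 := by linear_combination a1 * hC + a2 * h
      rcases mul_eq_zero.1 this with h | h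
      · exact absurd h h0.ne'
      · exact h.ge
    · by_contra hneg
      push Not at hneg
      nlinarith [sq_nonneg (a1 * a2 - a0 * a3), mul_pos h (neg_pos.2 hneg)]
  have i1 : K ^ 2 * (K + 1) * (f1 ^ 2 - f0 * f2) = a1 ^ 2 + K * (a1 ^ 2 - a0 * a2) := by
    rw [e1, e2, e0]; ring
  have i2 : K ^ 2 * (K + 1) ^ 2 * (K + 2) * (f2 ^ 2 - f1 * f3)
      = a2 ^ 2 + (K + 1) * (a2 ^ 2 - a1 * a3) := by
    rw [e1, e2, e3]; ring
  have i3 : K ^ 2 * (K + 1) * (K + 2) * (f1 * f2 - f0 * f3)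
      = 2 * (a1 * a2) + K * (a1 * a2 - a0 * a3) := by
    rw [e0, e1, e2, e3]; ring
  generalize hAe : a1 ^ 2 - a0 * a2 = A at *
  generalize hBe : a2 ^ 2 - a1 * a3 = B at *
  generalize hCe : a1 * a2 - a0 * a3 = D at *
  generalize f1 ^ 2 - f0 * f2 = U at *
  generalize f2 ^ 2 - f1 * f3 = V at *
  generalize f1 * f2 - f0 * f3 = W at *
  have cs : a1 * a2 * D ≤ a1 ^ 2 * B + a2 ^ 2 * A := by
    apply le_of_abs_le
    apply abs_le_of_sq_le_sq _ (by positivity)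
    have : (a1 * a2) ^ 2 * D ^ 2 ≤ (a1 * a2) ^ 2 * (4 * A * B) := by gcongr
    nlinarith [sq_nonneg (a1 ^ 2 * B - a2 ^ 2 * A)]
  have m1 : (2 * (a1 * a2) + K * D) ^ 2 ≤ 4 * (a1 ^ 2 + K * A) * (a2 ^ 2 + K * B) := by
    have := mul_le_mul_of_nonneg_left cs hK.le
    have := mul_le_mul_of_nonneg_left hT (sq_nonneg K)
    nlinarith
  have m2 : 4 * (a1 ^ 2 + K * A) * (a2 ^ 2 + K * B)
      ≤ 4 * (a1 ^ 2 + K * A) * (a2 ^ 2 + (K + 1) * B) := by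
    gcongr; linarith
  have m3 := m1.trans m2
  rw [← i1, ← i2, ← i3] at m3
  have hUV : 0 ≤ U * V := by
    have hU : 0 ≤ K ^ 2 * (K + 1) * U := by rw [i1]; positivity
    have hV : 0 ≤ K ^ 2 * (K + 1) ^ 2 * (K + 2) * V := by rw [i2]; positivity
    have hU' : 0 ≤ U := nonneg_of_mul_nonneg_right hU (by positivity)
    have hV' : 0 ≤ V := nonneg_of_mul_nonneg_right hV (by positivity)
    positivity
  have m4 : (K ^ 4 * (K + 1) ^ 2 * (K + 2)) * ((K + 2) * W ^ 2)
      ≤ (K ^ 4 * (K + 1) ^ 2 * (K + 2)) * ((K + 1) * (4 * (U * V))) := by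
    nlinarith
  have m5 := le_of_mul_le_mul_left m4 (by positivity)
  have m6 : (K + 2) * W ^ 2 ≤ (K + 2) * (4 * U * V) := by nlinarith
  exact le_of_mul_le_mul_left m6 (by positivity)

theorem coeff_turan (p : ℝ[X]) (hp : p.Splits) (k : ℕ) (h0 : 0 < p.coeff k)
    (h1 : 0 < p.coeff (k + 1)) (h2 : 0 < p.coeff (k + 2)) :
    (p.coeff (k + 1) * p.coeff (k + 2) - p.coeff k * p.coeff (k + 3)) ^ 2 ≤
      4 * (p.coeff (k + 1) ^ 2 - p.coeff k * p.coeff (k + 2)) *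
        (p.coeff (k + 2) ^ 2 - p.coeff (k + 1) * p.coeff (k + 3)) := by
  have hk : (0 : ℝ) < k.factorial := by exact_mod_cast k.factorial_pos
  have q : ∀ j, (j.factorial : ℝ) * (derivative^[k] p).coeff j
      = ((j + k).factorial : ℝ) * p.coeff (j + k) := by
    intro j
    rw [coeff_iterate_derivative, nsmul_eq_mul, ← mul_assoc]
    congr 1
    have := Nat.factorial_mul_descFactorial (n := j + k) (k := k) (by omega)
    rw [Nat.add_sub_cancel] at this
    exact_mod_cast this
  have q0 := q 0
  have q1 := q 1
  have q2 := q 2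
  have q3 := q 3
  have s1 : 1 + k = k + 1 := by omega
  have s2 : 2 + k = k + 2 := by omega
  have s3 : 3 + k = k + 3 := by omega
  rw [zero_add] at q0
  rw [s1] at q1
  rw [s2] at q2
  rw [s3] at q3
  simp only [Nat.factorial_succ, Nat.factorial_zero] at q0 q1 q2 q3
  push_cast at q0 q1 q2 q3
  obtain ⟨c, p1, p2, p3, g2, g3, c0, c1, c2, c3⟩ :=
    PowForm.of_splits _ (splits_iterate_derivative_real p hp k) (by
      have := mul_pos hk h0
      intro h
      rw [h] at q0
      linarith)
  rw [c0] at q0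
  rw [c1] at q1
  have r0 : c / k.factorial = p.coeff k := by field_simp; linarith
  have r1 : c * p1 / k.factorial = (k + 1) * p.coeff (k + 1) := by field_simp; linarith
  have r2 : c * (p1 ^ 2 - p2) / k.factorial = (k + 1) * (k + 1 + 1) * p.coeff (k + 2) := by
    field_simp; linarith
  have r3 : c * (p1 ^ 3 - 3 * p1 * p2 + 2 * p3) / k.factorial
      = (k + 1) * (k + 1 + 1) * (k + 1 + 2) * p.coeff (k + 3) := by
    field_simp; linarith
  refine turan_weight (k + 1) _ _ _ _ _ _ _ _ (by positivity) ?_ ?_ ?_ ?_ ?_ r0 r1 r2 r3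
  · rw [r0]; exact h0
  · rw [r1]; positivity
  · rw [r2]; positivity
  · have : (c * p1 / k.factorial) ^ 2 - c / k.factorial * (c * (p1 ^ 2 - p2) / k.factorial)
      = (c / k.factorial) ^ 2 * p2 := by ring
    rw [this]; positivity
  · rw [← sub_nonneg]
    have := mul_nonneg (by positivity : 0 ≤ 4 * (c / k.factorial) ^ 4) (sub_nonneg.2 g3)
    refine this.trans (le_of_eq ?_)
    ring

theorem speyerG_higher_turan (t : ℝ) (ht : 0 < t) (n : ℕ) (hn : 5 ≤ n) :
    ∀ d : ℕ, 2 ≤ d → d ≤ n - 3 →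
      (speyerG n d t * speyerG n (d + 1) t - speyerG n (d - 1) t * speyerG n (d + 2) t) ^ 2
        ≤ 4 * ((speyerG n d t) ^ 2 - speyerG n (d - 1) t * speyerG n (d + 1) t)
            * ((speyerG n (d + 1) t) ^ 2 - speyerG n d t * speyerG n (d + 2) t) := by
  intro d hd hdn
  obtain ⟨k, rfl⟩ := Nat.exists_eq_add_of_le' hd
  obtain ⟨m, rfl⟩ := Nat.exists_eq_add_of_le' (by omega : 2 ≤ n)
  have h := coeff_turan (genF t m) (genF_splits t ht m) k (genF_coeff_pos t ht m _ (by omega))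
    (genF_coeff_pos t ht m _ (by omega)) (genF_coeff_pos t ht m _ (by omega))
  have e0 : speyerG (m + 2) (k + 2 - 1) t = _ := speyerG_eq t m k
  have e1 : speyerG (m + 2) (k + 2) t = _ := speyerG_eq t m (k + 1)
  have e2 : speyerG (m + 2) (k + 2 + 1) t = _ := speyerG_eq t m (k + 2)
  have e3 : speyerG (m + 2) (k + 2 + 2) t = _ := speyerG_eq t m (k + 3)
  rw [e0, e1, e2, e3]
  have := mul_le_mul_of_nonneg_left h (by positivity : 0 ≤ t ^ 4)
  nlinarith
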